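/- Let A₁, A₂, A₃, A₄ be pairwise transverse affine parabolic spaces in 𝔰𝔩ₙ(ℝ). Then β(A₁,A₂,A₃,A₄) = β(A₂,A₁,A₄,A₃) = −ω₀ β(A₃,A₄,A₁,A₂) = −ω₀ β(A₄,A₃,A₂,A₁). -/

import Mathlib

open Matrix

noncomputable section

abbrev Mn (n : ℕ) := Matrix (Fin n) (Fin n) ℝ

/-- Conjugation `Z ↦ g Z g⁻¹` as a linear map on matrices. -/
def AdM {n : ℕ} (g : Mn n) : Mn n →ₗ[ℝ] Mn n where
  toFun Z := g * Z * g⁻¹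
  map_add' X Y := by simp [Matrix.add_mul, Matrix.mul_add]
  map_smul' c X := by simp [Matrix.smul_mul, Matrix.mul_smul]

/-- Projection onto the diagonal part. -/
def pi0 {n : ℕ} : Mn n →ₗ[ℝ] Mn n where
  toFun Z := Matrix.diagonal (fun i => Z i i)
  map_add' X Y := by
    ext i j
    by_cases h : i = j <;> simp [Matrix.diagonal_apply, h]
  map_smul' c X := by
    ext i j
    by_cases h : i = j <;> simp [Matrix.diagonal_apply, h]

/-- The involution reversing the diagonal entries (on diagonal matrices). -/
def omega0 {n : ℕ} : Mn n →ₗ[ℝ] Mn n where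
  toFun Z := Matrix.diagonal (fun i => Z i.rev i.rev)
  map_add' X Y := by
    ext i j
    by_cases h : i = j <;> simp [Matrix.diagonal_apply, h]
  map_smul' c X := by
    ext i j
    by_cases h : i = j <;> simp [Matrix.diagonal_apply, h]

/-- Traceless matrices: 𝔰𝔩ₙ(ℝ). -/
def slSub (n : ℕ) : Submodule ℝ (Mn n) := LinearMap.ker (Matrix.traceLinearMap (Fin n) ℝ ℝ)

/-- Matrices vanishing below the diagonal (upper triangular). -/
def upTri (n : ℕ) : Submodule ℝ (Mn n) where
  carrier := {Z | ∀ i j : Fin n, j < i → Z i j = 0}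
  add_mem' := by intro a b ha hb i j h; simp [Matrix.add_apply, ha i j h, hb i j h]
  zero_mem' := by intro i j h; rfl
  smul_mem' := by intro c a ha i j h; simp [Matrix.smul_apply, ha i j h]

/-- Matrices vanishing above the diagonal (lower triangular). -/
def loTri (n : ℕ) : Submodule ℝ (Mn n) where
  carrier := {Z | ∀ i j : Fin n, i < j → Z i j = 0}
  add_mem' := by intro a b ha hb i j h; simp [Matrix.add_apply, ha i j h, hb i j h]
  zero_mem' := by intro i j h; rfl
  smul_mem' := by intro c a ha i j h; simp [Matrix.smul_apply, ha i j h]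

/-- Diagonal matrices. -/
def diagSub (n : ℕ) : Submodule ℝ (Mn n) where
  carrier := {Z | ∀ i j : Fin n, i ≠ j → Z i j = 0}
  add_mem' := by intro a b ha hb i j h; simp [Matrix.add_apply, ha i j h, hb i j h]
  zero_mem' := by intro i j h; rfl
  smul_mem' := by intro c a ha i j h; simp [Matrix.smul_apply, ha i j h]

/-- Strictly upper triangular matrices: 𝔫⁺. -/
def nplus (n : ℕ) : Submodule ℝ (Mn n) where
  carrier := {Z | ∀ i j : Fin n, j ≤ i → Z i j = 0}
  add_mem' := by intro a b ha hb i j h; simp [Matrix.add_apply, ha i j h, hb i j h]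
  zero_mem' := by intro i j h; rfl
  smul_mem' := by intro c a ha i j h; simp [Matrix.smul_apply, ha i j h]

/-- Strictly lower triangular matrices: 𝔫⁻. -/
def nminus (n : ℕ) : Submodule ℝ (Mn n) where
  carrier := {Z | ∀ i j : Fin n, i ≤ j → Z i j = 0}
  add_mem' := by intro a b ha hb i j h; simp [Matrix.add_apply, ha i j h, hb i j h]
  zero_mem' := by intro i j h; rfl
  smul_mem' := by intro c a ha i j h; simp [Matrix.smul_apply, ha i j h]

/-- 𝔟⁺ : traceless upper triangular matrices. -/
def bplus (n : ℕ) : Submodule ℝ (Mn n) := slSub n ⊓ upTri n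

/-- 𝔟⁻ : traceless lower triangular matrices. -/
def bminus (n : ℕ) : Submodule ℝ (Mn n) := slSub n ⊓ loTri n

/-- 𝔞 : traceless diagonal matrices. -/
def aSub (n : ℕ) : Submodule ℝ (Mn n) := slSub n ⊓ diagSub n

/-- A parabolic subspace of 𝔰𝔩ₙ(ℝ): a subspace of the form Ad(g)𝔟⁺ with g ∈ SLₙ(ℝ). -/
def IsParabolic {n : ℕ} (V : Submodule ℝ (Mn n)) : Prop :=
  ∃ g : Mn n, g.det = 1 ∧ V = (bplus n).map (AdM g)

/-- Two subspaces are transverse if together they span 𝔰𝔩ₙ(ℝ). -/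
def Transv {n : ℕ} (V W : Submodule ℝ (Mn n)) : Prop := V ⊔ W = slSub n

/-- A standardizer of an ordered transverse pair of parabolic subspaces. -/
def IsStd {n : ℕ} (h : Mn n) (V₁ V₂ : Submodule ℝ (Mn n)) : Prop :=
  h.det = 1 ∧ (bplus n).map (AdM h) = V₁ ∧ (bminus n).map (AdM h) = V₂

/-- ν*_{i,j} computed with the standardizer h. -/
def nustar {n : ℕ} (h : Mn n) : Mn n →ₗ[ℝ] Mn n := pi0 ∘ₗ AdM h⁻¹

/-- ν_{i,j} computed with the standardizer h. -/
def nuMap {n : ℕ} (h : Mn n) : Mn n →ₗ[ℝ] Mn n := AdM h ∘ₗ pi0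

/-- π_{i,j} computed with the standardizer h. -/
def piStd {n : ℕ} (h : Mn n) : Mn n →ₗ[ℝ] Mn n := AdM h ∘ₗ pi0 ∘ₗ AdM h⁻¹

/-- The commutator subspace [V,V]. -/
def commSub {n : ℕ} (V : Submodule ℝ (Mn n)) : Submodule ℝ (Mn n) :=
  Submodule.span ℝ {z | ∃ x ∈ V, ∃ y ∈ V, z = x * y - y * x}

/-- An affine parabolic space with direction V: an affine subspace X + V of 𝔰𝔩ₙ(ℝ)
whose direction V is a parabolic subspace. -/
def IsAffPara {n : ℕ} (A : Set (Mn n)) (V : Submodule ℝ (Mn n)) : Prop :=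
  IsParabolic V ∧ ∃ X : Mn n, X ∈ slSub n ∧ A = {Z | Z - X ∈ V}

/-- `IsCross b A₁ A₂ A₃ A₄ V₁ V₂ V₃ V₄` : b is a value of the affine cross ratio
β(A₁,A₂,A₃,A₄), computed with some choice of standardizers and intersection points. -/
def IsCross {n : ℕ} (b : Mn n) (A₁ A₂ A₃ A₄ : Set (Mn n))
    (V₁ V₂ V₃ V₄ : Submodule ℝ (Mn n)) : Prop :=
  ∃ h₁₄ h₂₃ : Mn n, ∃ X₁₃ X₂₄ : Mn n,
    IsStd h₁₄ V₁ V₄ ∧ IsStd h₂₃ V₂ V₃ ∧ X₁₃ ∈ A₁ ∩ A₃ ∧ X₂₄ ∈ A₂ ∩ A₄ ∧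
    b = nustar h₁₄ (X₁₃ - X₂₄) - nustar h₂₃ (X₁₃ - X₂₄)

/-- `IsTriple d A₂ A₃ A₄ V₂ V₃ V₄` : d is a value of the affine triple ratio
δ(A₂,A₃,A₄), computed with some choice of standardizers and points. -/
def IsTriple {n : ℕ} (d : Mn n) (A₂ A₃ A₄ : Set (Mn n))
    (V₂ V₃ V₄ : Submodule ℝ (Mn n)) : Prop :=
  ∃ h₂₃ h₃₂ h₃₄ h₄₃ h₄₂ h₂₄ : Mn n, ∃ X₂ X₃ X₄ : Mn n,
    IsStd h₂₃ V₂ V₃ ∧ IsStd h₃₂ V₃ V₂ ∧ IsStd h₃₄ V₃ V₄ ∧ IsStd h₄₃ V₄ V₃ ∧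
    IsStd h₄₂ V₄ V₂ ∧ IsStd h₂₄ V₂ V₄ ∧ X₂ ∈ A₂ ∧ X₃ ∈ A₃ ∧ X₄ ∈ A₄ ∧
    d = (nustar h₂₃ (X₂ - X₃) + nustar h₃₂ (X₂ - X₃))
      + (nustar h₃₄ (X₃ - X₄) + nustar h₄₃ (X₃ - X₄))
      + (nustar h₄₂ (X₄ - X₂) + nustar h₂₄ (X₄ - X₂))

/-- The affine action of (g,Y) ∈ SLₙ(ℝ) ⋉ 𝔰𝔩ₙ(ℝ) on 𝔰𝔩ₙ(ℝ). -/
def affMap {n : ℕ} (g Y : Mn n) : Mn n → Mn n := fun Z => g * Z * g⁻¹ + Y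

/-- The permutation matrix of the order-reversing permutation. -/
def revMatrix (n : ℕ) : Mn n := (Fin.revPerm : Equiv.Perm (Fin n)).permMatrix ℝ

lemma revMatrix_mul_mul_revMatrix {n : ℕ} (Z : Mn n) :
    revMatrix n * Z * revMatrix n = Z.submatrix Fin.rev Fin.rev := by
  rw [revMatrix, Equiv.Perm.permMatrix, PEquiv.toMatrix_toPEquiv_mul, PEquiv.mul_toMatrix_toPEquiv]
  ext i j
  simp

lemma revMatrix_mul_self (n : ℕ) : revMatrix n * revMatrix n = 1 := by
  have h := revMatrix_mul_mul_revMatrix (1 : Mn n)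
  rw [Matrix.mul_one] at h
  rw [h]
  exact Matrix.submatrix_one _ Fin.rev_injective

lemma isUnit_det_revMatrix (n : ℕ) : IsUnit (revMatrix n).det :=
  Matrix.isUnit_det_of_left_inverse (revMatrix_mul_self n)

lemma AdM_revMatrix {n : ℕ} (Z : Mn n) :
    AdM (revMatrix n) Z = Z.submatrix Fin.rev Fin.rev := by
  have h : (revMatrix n)⁻¹ = revMatrix n := Matrix.inv_eq_left_inv (revMatrix_mul_self n)
  change revMatrix n * Z * (revMatrix n)⁻¹ = _
  rw [h, revMatrix_mul_mul_revMatrix]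

lemma AdM_mul {n : ℕ} (g h : Mn n) : AdM (g * h) = AdM g ∘ₗ AdM h := by
  ext1 Z
  simp [AdM, Matrix.mul_inv_rev, Matrix.mul_assoc]

lemma trace_submatrix_rev {n : ℕ} (Z : Mn n) :
    (Z.submatrix Fin.rev Fin.rev).trace = Z.trace :=
  Equiv.sum_comp Fin.revPerm fun i => Z i i

lemma submatrix_rev_mem_bminus {n : ℕ} {Z : Mn n} (hZ : Z ∈ bplus n) :
    Z.submatrix Fin.rev Fin.rev ∈ bminus n := by
  refine ⟨?_, fun i j h => hZ.2 _ _ (Fin.rev_lt_rev.2 h)⟩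
  change (Z.submatrix Fin.rev Fin.rev).trace = 0
  rw [trace_submatrix_rev]
  exact hZ.1

lemma submatrix_rev_mem_bplus {n : ℕ} {Z : Mn n} (hZ : Z ∈ bminus n) :
    Z.submatrix Fin.rev Fin.rev ∈ bplus n := by
  refine ⟨?_, fun i j h => hZ.2 _ _ (Fin.rev_lt_rev.2 h)⟩
  change (Z.submatrix Fin.rev Fin.rev).trace = 0
  rw [trace_submatrix_rev]
  exact hZ.1

lemma submatrix_rev_rev {n : ℕ} (Z : Mn n) :
    (Z.submatrix Fin.rev Fin.rev).submatrix Fin.rev Fin.rev = Z := by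
  ext i j
  simp

lemma map_AdM_revMatrix_bplus (n : ℕ) : (bplus n).map (AdM (revMatrix n)) = bminus n := by
  ext Z
  constructor
  · rintro ⟨Y, hY, rfl⟩
    rw [AdM_revMatrix]
    exact submatrix_rev_mem_bminus hY
  · intro hZ
    exact ⟨_, submatrix_rev_mem_bplus hZ, by rw [AdM_revMatrix, submatrix_rev_rev]⟩

lemma map_AdM_revMatrix_bminus (n : ℕ) : (bminus n).map (AdM (revMatrix n)) = bplus n := by
  rw [← map_AdM_revMatrix_bplus, ← Submodule.map_comp, ← AdM_mul, revMatrix_mul_self]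
  convert Submodule.map_id _
  ext1 Z
  simp [AdM]

lemma pi0_submatrix_rev {n : ℕ} (Z : Mn n) :
    pi0 (Z.submatrix Fin.rev Fin.rev) = omega0 Z := rfl

lemma omega0_omega0 {n : ℕ} (Z : Mn n) : omega0 (omega0 Z) = pi0 Z := by
  simp [omega0, pi0]

lemma omega0_pi0 {n : ℕ} (Z : Mn n) : omega0 (pi0 Z) = omega0 Z := by
  simp [omega0, pi0]

lemma pi0_pi0 {n : ℕ} (Z : Mn n) : pi0 (pi0 Z) = pi0 Z := by
  simp [pi0]

/-- A matrix that normalizes the upper triangular matrices is upper triangular. -/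
lemma mem_upTri_of_conj {n : ℕ} {M P : Mn n} (hMP : M * P = 1)
    (h : ∀ Z ∈ upTri n, M * Z * P ∈ upTri n) : M ∈ upTri n := by
  suffices H : ∀ (j i : Fin n), j < i → M i j = 0 from fun i j => H j i
  intro j
  induction j using WellFoundedLT.induction with
  | ind j ih =>
    intro i hji
    by_contra hne
    have hP : ∀ l, j ≤ l → P l j = 0 := by
      intro l hl
      have hS : Matrix.single j l (1 : ℝ) ∈ upTri n := by
        intro a b hab
        apply Matrix.single_apply_of_ne
        rintro ⟨rfl, rfl⟩
        exact absurd hl (not_le.2 hab)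
      have h0 := h _ hS i j hji
      have h1 : (M * Matrix.single j l (1 : ℝ) * P) i j = M i j * P l j := by
        rw [Matrix.mul_assoc, Matrix.mul_apply, Finset.sum_eq_single j]
        · simp
        · intro b _ hb
          rw [Matrix.single_mul_apply_of_ne _ _ _ _ _ hb, mul_zero]
        · simp
      rw [h1] at h0
      exact (mul_eq_zero.1 h0).resolve_left hne
    have h1 : (M * P) j j = 1 := by rw [hMP, Matrix.one_apply_eq]
    rw [Matrix.mul_apply, Finset.sum_eq_zero] at h1
    · exact zero_ne_one h1
    · intro l _
      rcases lt_or_ge l j with hl | hl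
      · rw [ih l hl j hl, zero_mul]
      · rw [hP l hl, mul_zero]

lemma mul_apply_self_of_mem_upTri {n : ℕ} {A B : Mn n} (hA : A ∈ upTri n) (hB : B ∈ upTri n)
    (i : Fin n) : (A * B) i i = A i i * B i i := by
  rw [Matrix.mul_apply, Finset.sum_eq_single i]
  · intro l _ hl
    rcases lt_or_gt_of_ne hl with h | h
    · rw [hA i l h, zero_mul]
    · rw [hB l i h, mul_zero]
  · simp

lemma apply_self_ne_zero_of_mem_upTri {n : ℕ} {M : Mn n} (hM : M ∈ upTri n)
    (hdet : IsUnit M.det) (i : Fin n) : M i i ≠ 0 := by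
  rw [Matrix.det_of_isUpperTriangular (fun a b h => hM a b h)] at hdet
  exact Finset.prod_ne_zero_iff.1 hdet.ne_zero i (Finset.mem_univ i)

lemma pi0_eq_of_conj {n : ℕ} {M P Z Z' : Mn n} (hMP : M * P = 1)
    (h : ∀ Z ∈ bplus n, M * Z * P ∈ bplus n) (hZ : Z ∈ bplus n) (hZ' : M * Z * P = Z') :
    pi0 Z = pi0 Z' := by
  have hPM : P * M = 1 := mul_eq_one_comm.1 hMP
  have hM : M ∈ upTri n := by
    refine mem_upTri_of_conj hMP fun Y hY i j hij => ?_
    have hn : (n : ℝ) ≠ 0 := by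
      have := i.pos
      positivity
    have hY' : Y - (Y.trace / n) • (1 : Mn n) ∈ bplus n := by
      refine ⟨?_, fun a b hab => ?_⟩
      · change (Y - (Y.trace / n) • (1 : Mn n)).trace = 0
        simp [Matrix.trace_sub, Matrix.trace_smul, hn]
      · simp [hY a b hab, Matrix.one_apply_ne hab.ne']
    have h0 := (h _ hY').2 i j hij
    have h1 : M * (Y - (Y.trace / n) • (1 : Mn n)) * P
        = M * Y * P - (Y.trace / n) • (1 : Mn n) := by
      rw [Matrix.mul_sub, Matrix.sub_mul, Matrix.mul_smul, Matrix.mul_one, Matrix.smul_mul, hMP]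
    rw [h1] at h0
    simpa [Matrix.one_apply_ne hij.ne'] using h0
  have hZ'm : Z' ∈ bplus n := hZ' ▸ h Z hZ
  have hcomm : M * Z = Z' * M := by
    rw [← hZ', Matrix.mul_assoc, hPM, Matrix.mul_one]
  change Matrix.diagonal _ = Matrix.diagonal _
  congr 1
  funext i
  have h1 := mul_apply_self_of_mem_upTri hM hZ.2 i
  rw [hcomm, mul_apply_self_of_mem_upTri hZ'm.2 hM, mul_comm] at h1
  exact (mul_left_cancel₀ (apply_self_ne_zero_of_mem_upTri hM
    (Matrix.isUnit_det_of_right_inverse hMP) i) h1).symm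

lemma dotProduct_eq_zero_of_disjoint {ι : Type*} [Fintype ι] {p : ι → Prop} {u v : ι → ℝ}
    (hu : ∀ i, p i → u i = 0) (hv : ∀ i, ¬ p i → v i = 0) : u ⬝ᵥ v = 0 := by
  refine Finset.sum_eq_zero fun i _ => ?_
  by_cases h : p i
  · rw [hu i h, zero_mul]
  · rw [hv i h, mul_zero]

/-- If the upper triangular matrices and the conjugates by `M⁻¹` of the lower triangular matrices
together span `𝔰𝔩ₙ(ℝ)`, then the leading principal minors of `M` are nonzero. -/
lemma det_toBlock_ne_zero {n : ℕ} {M P : Mn n} (hMP : M * P = 1)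
    (h : ∀ X ∈ slSub n, ∃ U ∈ upTri n, ∃ L ∈ loTri n, X = U + P * L * M) (k : ℕ) :
    (M.toBlock (fun i => i.val < k) (fun i => i.val < k)).det ≠ 0 := by
  intro hdet
  obtain ⟨v, hv0, hv⟩ := Matrix.exists_mulVec_eq_zero_iff.2 hdet
  obtain ⟨u, hu0, hu⟩ := Matrix.exists_vecMul_eq_zero_iff.2 hdet
  let v' : Fin n → ℝ := fun i => if hi : i.val < k then v ⟨i, hi⟩ else 0
  let u' : Fin n → ℝ := fun i => if hi : i.val < k then u ⟨i, hi⟩ else 0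
  have hv'n : ∀ i : Fin n, ¬ i.val < k → v' i = 0 := fun i hi => dif_neg hi
  have hu'n : ∀ i : Fin n, ¬ i.val < k → u' i = 0 := fun i hi => dif_neg hi
  have hext : ∀ (w : {i : Fin n // i.val < k} → ℝ) (a : Fin n → ℝ),
      (∑ i : Fin n, a i * (if hi : i.val < k then w ⟨i, hi⟩ else 0))
        = ∑ i : {i : Fin n // i.val < k}, a i * w i := by
    intro w a
    rw [← Fintype.sum_subtype_add_sum_subtype (fun i : Fin n => i.val < k)]
    rw [Finset.sum_eq_zero (s := (Finset.univ : Finset {i : Fin n // ¬ i.val < k})), add_zero]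
    · exact Finset.sum_congr rfl fun i _ => by rw [dif_pos i.2]
    · intro i _
      rw [dif_neg i.2, mul_zero]
  have hMv : ∀ i : Fin n, i.val < k → (M *ᵥ v') i = 0 := fun i hi =>
    (hext v (M i)).trans (congrFun hv ⟨i, hi⟩)
  have huM : ∀ j : Fin n, j.val < k → (u' ᵥ* M) j = 0 := by
    intro j hj
    refine Eq.trans ?_ (congrFun hu ⟨j, hj⟩)
    rw [← Matrix.mulVec_transpose, ← Matrix.mulVec_transpose]
    exact hext u (fun i => M i j)
  set f := u' ᵥ* M with hf
  have hv'0 : v' ≠ 0 := by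
    intro h0
    apply hv0
    funext i
    have := congrFun h0 i.1
    simpa [v', i.2] using this
  have hu'0 : u' ≠ 0 := by
    intro h0
    apply hu0
    funext i
    have := congrFun h0 i.1
    simpa [u', i.2] using this
  have hfP : f ᵥ* P = u' := by rw [hf, Matrix.vecMul_vecMul, hMP, Matrix.vecMul_one]
  have hf0 : f ≠ 0 := by
    intro h0
    rw [h0, Matrix.zero_vecMul] at hfP
    exact hu'0 hfP.symm
  obtain ⟨U, hU, L, hL, hX⟩ := h (Matrix.vecMulVec f v') (by
    change (Matrix.vecMulVec f v').trace = 0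
    rw [Matrix.trace_vecMulVec]
    exact dotProduct_eq_zero_of_disjoint huM hv'n)
  have hfX : f ⬝ᵥ (Matrix.vecMulVec f v' *ᵥ v') = (f ⬝ᵥ f) * (v' ⬝ᵥ v') := by
    rw [Matrix.dotProduct_mulVec, Matrix.vecMul_vecMulVec, smul_dotProduct, smul_eq_mul]
  have hfU : f ⬝ᵥ (U *ᵥ v') = 0 := by
    refine dotProduct_eq_zero_of_disjoint huM fun i hi => ?_
    refine dotProduct_eq_zero_of_disjoint (p := fun j : Fin n => j.val < k) (fun j hj => ?_) hv'n
    exact hU i j (Fin.lt_def.2 (by omega))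
  have hfL : f ⬝ᵥ ((P * L * M) *ᵥ v') = 0 := by
    rw [← Matrix.mulVec_mulVec, ← Matrix.mulVec_mulVec, Matrix.dotProduct_mulVec, hfP,
      Matrix.dotProduct_mulVec, dotProduct_comm]
    refine dotProduct_eq_zero_of_disjoint hMv fun j hj => ?_
    rw [Matrix.vecMul, dotProduct_comm]
    refine dotProduct_eq_zero_of_disjoint (p := fun i : Fin n => i.val < k) (fun i hi => ?_) hu'n
    exact hL i j (Fin.lt_def.2 (by omega))
  rw [hX, Matrix.add_mulVec, dotProduct_add, hfU, hfL, add_zero] at hfX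
  rcases mul_eq_zero.1 hfX.symm with h0 | h0
  · exact hf0 (dotProduct_self_eq_zero.1 h0)
  · exact hv'0 (dotProduct_self_eq_zero.1 h0)

lemma trace_toBlock_eq {n : ℕ} {M Z L : Mn n} (hZ : Z ∈ upTri n) (hL : L ∈ loTri n)
    (hcomm : M * Z = L * M) (k : ℕ)
    (hdet : (M.toBlock (fun i => i.val < k) (fun i => i.val < k)).det ≠ 0) :
    (Z.toBlock (fun i => i.val < k) (fun i => i.val < k)).trace
      = (L.toBlock (fun i => i.val < k) (fun i => i.val < k)).trace := by
  set p : Fin n → Prop := fun i => i.val < k with hp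
  have hZ0 : Z.toBlock (fun i => ¬ p i) p = 0 := by
    ext i j
    have hi := i.2
    have hj := j.2
    simp only [hp] at hi hj
    exact hZ i j (Fin.lt_def.2 (by omega))
  have hL0 : L.toBlock p (fun i => ¬ p i) = 0 := by
    ext i j
    have hi := i.2
    have hj := j.2
    simp only [hp] at hi hj
    exact hL i j (Fin.lt_def.2 (by omega))
  have h1 : M.toBlock p p * Z.toBlock p p = L.toBlock p p * M.toBlock p p := by
    have h2 := Matrix.toBlock_mul_eq_add p p p M Z
    have h3 := Matrix.toBlock_mul_eq_add p p p L M
    rw [hZ0, Matrix.mul_zero, add_zero] at h2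
    rw [hL0, Matrix.zero_mul, add_zero] at h3
    rw [← h2, ← h3, hcomm]
  have hu : IsUnit (M.toBlock p p).det := isUnit_iff_ne_zero.2 hdet
  have h4 : Z.toBlock p p = (M.toBlock p p)⁻¹ * (L.toBlock p p * M.toBlock p p) := by
    rw [← h1, Matrix.nonsing_inv_mul_cancel_left _ _ hu]
  rw [h4, Matrix.trace_mul_comm, Matrix.mul_assoc, Matrix.mul_nonsing_inv _ hu, Matrix.mul_one]

lemma trace_toBlock_succ {n : ℕ} (Z : Mn n) (i : Fin n) :
    (Z.toBlock (fun j => j.val < i.val + 1) (fun j => j.val < i.val + 1)).trace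
      = Z i i + (Z.toBlock (fun j => j.val < i.val) (fun j => j.val < i.val)).trace := by
  have key : ∀ k : ℕ, (Z.toBlock (fun j => j.val < k) (fun j => j.val < k)).trace
      = ∑ j ∈ Finset.univ.filter (fun j : Fin n => j.val < k), Z j j := fun k =>
    (Finset.sum_subtype (p := fun j : Fin n => j.val < k) _ (by simp) fun j => Z j j).symm
  have hins : Finset.univ.filter (fun j : Fin n => j.val < i.val + 1)
      = insert i (Finset.univ.filter fun j : Fin n => j.val < i.val) := by
    ext j
    simp [Fin.ext_iff]
    omega
  rw [key, key, hins, Finset.sum_insert (by simp)]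

lemma pi0_eq_of_transverse {n : ℕ} {M P Z L : Mn n} (hMP : M * P = 1)
    (h : ∀ X ∈ slSub n, ∃ U ∈ upTri n, ∃ L ∈ loTri n, X = U + P * L * M)
    (hZ : Z ∈ upTri n) (hL : L ∈ loTri n) (hcomm : M * Z = L * M) : pi0 Z = pi0 L := by
  change Matrix.diagonal _ = Matrix.diagonal _
  congr 1
  funext i
  have h1 := trace_toBlock_eq hZ hL hcomm (i.val + 1) (det_toBlock_ne_zero hMP h _)
  rw [trace_toBlock_succ, trace_toBlock_succ,
    trace_toBlock_eq hZ hL hcomm i.val (det_toBlock_ne_zero hMP h _)] at h1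
  exact add_right_cancel h1

/-- `d` is the diagonal part of `x ∈ V` in some frame carrying `𝔟⁺` to the parabolic subspace
`V`. -/
def IsDiagPart {n : ℕ} (V : Submodule ℝ (Mn n)) (x d : Mn n) : Prop :=
  ∃ g z : Mn n, IsUnit g.det ∧ (bplus n).map (AdM g) = V ∧ z ∈ bplus n ∧ AdM g z = x ∧ pi0 z = d

lemma AdM_inv_AdM {n : ℕ} {g : Mn n} (hg : IsUnit g.det) (z : Mn n) :
    AdM g⁻¹ (AdM g z) = z := by
  rw [← LinearMap.comp_apply, ← AdM_mul, Matrix.nonsing_inv_mul _ hg]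
  simp [AdM]

lemma AdM_inv_mul_apply {n : ℕ} {g g' : Mn n} (hg' : IsUnit g'.det) (Z : Mn n) :
    g'⁻¹ * g * Z * (g⁻¹ * g') = AdM g'⁻¹ (AdM g Z) := by
  simp [AdM, Matrix.nonsing_inv_nonsing_inv _ hg', Matrix.mul_assoc]

lemma inv_mul_mul_inv_mul {n : ℕ} {g g' : Mn n} (hg : IsUnit g.det) (hg' : IsUnit g'.det) :
    g'⁻¹ * g * (g⁻¹ * g') = 1 := by
  rw [Matrix.mul_assoc, Matrix.mul_nonsing_inv_cancel_left _ _ hg, Matrix.nonsing_inv_mul _ hg']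

lemma IsDiagPart.unique {n : ℕ} {V : Submodule ℝ (Mn n)} {x d d' : Mn n}
    (h : IsDiagPart V x d) (h' : IsDiagPart V x d') : d = d' := by
  obtain ⟨g, z, hg, hV, hz, hx, rfl⟩ := h
  obtain ⟨g', z', hg', hV', hz', hx', rfl⟩ := h'
  refine pi0_eq_of_conj (inv_mul_mul_inv_mul hg hg') (fun Z hZ => ?_) hz ?_
  · have hm : AdM g Z ∈ (bplus n).map (AdM g') := by
      rw [hV', ← hV]
      exact Submodule.mem_map_of_mem hZ
    obtain ⟨Y, hY, hYZ⟩ := hm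
    rw [AdM_inv_mul_apply hg', ← hYZ, AdM_inv_AdM hg']
    exact hY
  · rw [AdM_inv_mul_apply hg', hx, ← hx', AdM_inv_AdM hg']

lemma IsDiagPart.eq_omega0 {n : ℕ} {V W : Submodule ℝ (Mn n)} {x d d' : Mn n}
    (hVW : Transv V W) (h : IsDiagPart V x d) (h' : IsDiagPart W x d') : d = omega0 d' := by
  obtain ⟨g, z, hg, hV, hz, hx, rfl⟩ := h
  obtain ⟨g₁, z₁, hg₁, hW, hz₁, hx₁, rfl⟩ := h'
  obtain ⟨g', z', hg', hW', hz', hx', hd⟩ : ∃ g' z' : Mn n, IsUnit g'.det ∧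
      (bminus n).map (AdM g') = W ∧ z' ∈ bminus n ∧ AdM g' z' = x ∧ pi0 z' = omega0 z₁ := by
    refine ⟨g₁ * revMatrix n, z₁.submatrix Fin.rev Fin.rev, ?_, ?_,
      submatrix_rev_mem_bminus hz₁, ?_, rfl⟩
    · rw [Matrix.det_mul]
      exact hg₁.mul (isUnit_det_revMatrix n)
    · rw [AdM_mul, Submodule.map_comp, map_AdM_revMatrix_bminus, hW]
    · rw [AdM_mul, LinearMap.comp_apply, AdM_revMatrix, submatrix_rev_rev, hx₁]
  rw [omega0_pi0, ← hd]
  have hMP := inv_mul_mul_inv_mul hg hg'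
  have hconj : g'⁻¹ * g * z * (g⁻¹ * g') = z' := by
    rw [AdM_inv_mul_apply hg', hx, ← hx', AdM_inv_AdM hg']
  refine pi0_eq_of_transverse hMP (fun X hX => ?_) hz.2 hz'.2 ?_
  · have hX' : AdM g X ∈ V ⊔ W := by
      rw [hVW]
      change (g * X * g⁻¹).trace = 0
      rw [Matrix.trace_mul_comm, Matrix.nonsing_inv_mul_cancel_left _ _ hg]
      exact hX
    obtain ⟨v, hv, w, hw, hvw⟩ := Submodule.mem_sup.1 hX'
    rw [← hV] at hv
    rw [← hW'] at hw
    obtain ⟨U, hU, rfl⟩ := hv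
    obtain ⟨L, hL, rfl⟩ := hw
    refine ⟨U, hU.2, L, hL.2, ?_⟩
    rw [AdM_inv_mul_apply hg, ← AdM_inv_AdM hg X, ← hvw, map_add, AdM_inv_AdM hg]
  · rw [← hconj, Matrix.mul_assoc _ (g⁻¹ * g'), inv_mul_mul_inv_mul hg' hg, Matrix.mul_one]

lemma IsStd.isUnit_det {n : ℕ} {h : Mn n} {V W : Submodule ℝ (Mn n)} (hs : IsStd h V W) :
    IsUnit h.det := by
  rw [hs.1]
  exact isUnit_one

lemma IsStd.isDiagPart_left {n : ℕ} {h : Mn n} {V W : Submodule ℝ (Mn n)} (hs : IsStd h V W)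
    {x : Mn n} (hx : x ∈ V) : IsDiagPart V x (nustar h x) := by
  rw [← hs.2.1] at hx
  obtain ⟨z, hz, rfl⟩ := hx
  refine ⟨h, z, hs.isUnit_det, hs.2.1, hz, rfl, ?_⟩
  rw [nustar, LinearMap.comp_apply, AdM_inv_AdM hs.isUnit_det]

lemma IsStd.isDiagPart_right {n : ℕ} {h : Mn n} {V W : Submodule ℝ (Mn n)} (hs : IsStd h V W)
    {x : Mn n} (hx : x ∈ W) : IsDiagPart W x (omega0 (nustar h x)) := by
  rw [← hs.2.2] at hx
  obtain ⟨z, hz, rfl⟩ := hx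
  refine ⟨h * revMatrix n, z.submatrix Fin.rev Fin.rev, ?_, ?_, submatrix_rev_mem_bplus hz, ?_, ?_⟩
  · rw [Matrix.det_mul]
    exact hs.isUnit_det.mul (isUnit_det_revMatrix n)
  · rw [AdM_mul, Submodule.map_comp, map_AdM_revMatrix_bplus, hs.2.2]
  · rw [AdM_mul, LinearMap.comp_apply, AdM_revMatrix, submatrix_rev_rev]
  · rw [nustar, LinearMap.comp_apply, AdM_inv_AdM hs.isUnit_det, omega0_pi0, pi0_submatrix_rev]

lemma omega0_omega0_nustar {n : ℕ} (h x : Mn n) : omega0 (omega0 (nustar h x)) = nustar h x := by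
  rw [omega0_omega0, nustar, LinearMap.comp_apply, pi0_pi0]

lemma IsStd.nustar_eq {n : ℕ} {h h' : Mn n} {V W : Submodule ℝ (Mn n)} (hVW : Transv V W)
    (hs : IsStd h V W) (hs' : IsStd h' V W) {x : Mn n} (hx : x ∈ slSub n) :
    nustar h x = nustar h' x := by
  rw [← hVW] at hx
  obtain ⟨v, hv, w, hw, rfl⟩ := Submodule.mem_sup.1 hx
  have h1 := (hs.isDiagPart_left hv).unique (hs'.isDiagPart_left hv)
  have h2 := congrArg omega0 ((hs.isDiagPart_right hw).unique (hs'.isDiagPart_right hw))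
  rw [omega0_omega0_nustar, omega0_omega0_nustar] at h2
  rw [map_add, map_add, h1, h2]

lemma IsStd.nustar_eq_omega0 {n : ℕ} {h h' : Mn n} {V W : Submodule ℝ (Mn n)}
    (hVW : Transv V W) (hs : IsStd h V W) (hs' : IsStd h' W V) {x : Mn n} (hx : x ∈ slSub n) :
    nustar h x = omega0 (nustar h' x) := by
  rw [← hVW] at hx
  obtain ⟨v, hv, w, hw, rfl⟩ := Submodule.mem_sup.1 hx
  have h1 := (hs.isDiagPart_left hv).unique (hs'.isDiagPart_right hv)
  have h2 := congrArg omega0 ((hs.isDiagPart_right hw).unique (hs'.isDiagPart_left hw))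
  rw [omega0_omega0_nustar] at h2
  rw [map_add, map_add, map_add, h1, h2]

/-- Two standardized pairs `(V, W')`, `(V', W)` with `V`, `W` transverse induce the same map on
`V ∩ W`. -/
lemma IsStd.nustar_eq_of_mem {n : ℕ} {h h' : Mn n} {V W V' W' : Submodule ℝ (Mn n)}
    (hVW : Transv V W) (hs : IsStd h V W') (hs' : IsStd h' V' W) {x : Mn n}
    (hxV : x ∈ V) (hxW : x ∈ W) : nustar h x = nustar h' x := by
  rw [(hs.isDiagPart_left hxV).eq_omega0 hVW (hs'.isDiagPart_right hxW), omega0_omega0_nustar]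

lemma IsAffPara.sub_mem {n : ℕ} {A : Set (Mn n)} {V : Submodule ℝ (Mn n)} (hA : IsAffPara A V)
    {X Y : Mn n} (hX : X ∈ A) (hY : Y ∈ A) : X - Y ∈ V := by
  obtain ⟨-, Z, -, rfl⟩ := hA
  simpa using V.sub_mem hX hY

lemma IsAffPara.mem_slSub {n : ℕ} {A : Set (Mn n)} {V : Submodule ℝ (Mn n)} (hA : IsAffPara A V)
    (hV : V ≤ slSub n) {X : Mn n} (hX : X ∈ A) : X ∈ slSub n := by
  obtain ⟨-, Z, hZ, rfl⟩ := hA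
  simpa using (slSub n).add_mem (hV hX) hZ

/-- Let A₁, A₂, A₃, A₄ be pairwise transverse affine parabolic spaces in
𝔰𝔩ₙ(ℝ). Then β(A₁,A₂,A₃,A₄) = β(A₂,A₁,A₄,A₃) = −ω₀ β(A₃,A₄,A₁,A₂) = −ω₀ β(A₄,A₃,A₂,A₁). -/
theorem affine_cross_ratio_symmetries (n : ℕ) (hn : 2 ≤ n)
    (A₁ A₂ A₃ A₄ : Set (Mn n)) (V₁ V₂ V₃ V₄ : Submodule ℝ (Mn n))
    (h₁ : IsAffPara A₁ V₁) (h₂ : IsAffPara A₂ V₂)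
    (h₃ : IsAffPara A₃ V₃) (h₄ : IsAffPara A₄ V₄)
    (t₁₂ : Transv V₁ V₂) (t₁₃ : Transv V₁ V₃) (t₁₄ : Transv V₁ V₄)
    (t₂₃ : Transv V₂ V₃) (t₂₄ : Transv V₂ V₄) (t₃₄ : Transv V₃ V₄) :
    ∀ b₁ b₂ b₃ b₄ : Mn n,
      IsCross b₁ A₁ A₂ A₃ A₄ V₁ V₂ V₃ V₄ →
      IsCross b₂ A₂ A₁ A₄ A₃ V₂ V₁ V₄ V₃ →
      IsCross b₃ A₃ A₄ A₁ A₂ V₃ V₄ V₁ V₂ →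
      IsCross b₄ A₄ A₃ A₂ A₁ V₄ V₃ V₂ V₁ →
      b₁ = b₂ ∧ b₁ = -omega0 b₃ ∧ b₁ = -omega0 b₄ := by
  have hle₁ : V₁ ≤ slSub n := t₁₂ ▸ le_sup_left
  have hle₂ : V₂ ≤ slSub n := t₁₂ ▸ le_sup_right
  rintro b₁ b₂ b₃ b₄ ⟨h₁₄, h₂₃, X, Y, s₁₄, s₂₃, hX, hY, rfl⟩
    ⟨k₂₃, k₁₄, Y₂, X₂, r₂₃, r₁₄, hY₂, hX₂, rfl⟩ ⟨k₃₂, k₄₁, X₃, Y₃, r₃₂, r₄₁, hX₃, hY₃, rfl⟩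
    ⟨l₄₁, l₃₂, Y₄, X₄, q₄₁, q₃₂, hY₄, hX₄, rfl⟩
  have hsl : ∀ {P Q : Mn n}, P ∈ A₁ → Q ∈ A₂ → P - Q ∈ slSub n := fun hP hQ =>
    (slSub n).sub_mem (h₁.mem_slSub hle₁ hP) (h₂.mem_slSub hle₂ hQ)
  have indep : ∀ {P Q : Mn n}, P ∈ A₁ ∩ A₃ → Q ∈ A₂ ∩ A₄ →
      nustar h₁₄ (X - Y) - nustar h₂₃ (X - Y) = nustar h₁₄ (P - Q) - nustar h₂₃ (P - Q) := by
    intro P Q hP hQ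
    have e₁ := IsStd.nustar_eq_of_mem t₁₃ s₁₄ s₂₃ (h₁.sub_mem hX.1 hP.1) (h₃.sub_mem hX.2 hP.2)
    have e₂ := IsStd.nustar_eq_of_mem t₂₄ s₂₃ s₁₄ (h₂.sub_mem hY.1 hQ.1) (h₄.sub_mem hY.2 hQ.2)
    simp only [map_sub] at e₁ e₂ ⊢
    linear_combination (norm := abel) e₁ + e₂
  refine ⟨?_, ?_, ?_⟩
  · have hm := hsl hX₂.1 hY₂.1
    rw [indep hX₂ hY₂, s₁₄.nustar_eq t₁₄ r₁₄ hm, s₂₃.nustar_eq t₂₃ r₂₃ hm, ← neg_sub X₂ Y₂,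
      map_neg, map_neg]
    abel
  · have hm := hsl hX₃.2 hY₃.2
    rw [indep hX₃.symm hY₃.symm, s₁₄.nustar_eq_omega0 t₁₄ r₄₁ hm,
      s₂₃.nustar_eq_omega0 t₂₃ r₃₂ hm, map_sub omega0]
    abel
  · have hm := hsl hX₄.2 hY₄.2
    rw [indep hX₄.symm hY₄.symm, s₁₄.nustar_eq_omega0 t₁₄ q₄₁ hm,
      s₂₃.nustar_eq_omega0 t₂₃ q₃₂ hm, ← neg_sub X₄ Y₄, map_neg, map_neg, map_sub omega0,
      map_neg, map_neg]
    abel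
end
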